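/- For every integer d ≥ 1 and every integer x, the following identity holds in K: Σ_{r=0}^{d} [x−2r] · [2d−x choose d−r] · [x choose r] = 0. -/

import Mathlib

open Finset

/-- Symmetric q-integer `[n] = (qⁿ − q⁻ⁿ)/(q − q⁻¹)` for `n : ℤ`. -/
noncomputable def qint {K : Type*} [Field K] (q : K) (n : ℤ) : K :=
  (q ^ n - q ^ (-n)) / (q - q⁻¹)

/-- q-factorial `[n]! = [1][2]⋯[n]`. -/
noncomputable def qfact {K : Type*} [Field K] (q : K) : ℕ → K
  | 0 => 1
  | n + 1 => qfact q n * qint q ((n : ℤ) + 1)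

/-- Generalized q-binomial `[n choose k] = [n][n−1]⋯[n−k+1]/[k]!` for `n : ℤ`, `k : ℕ`. -/
noncomputable def qbinomG {K : Type*} [Field K] (q : K) (n : ℤ) (k : ℕ) : K :=
  (∏ i ∈ Finset.range k, qint q (n - i)) / qfact q k

theorem qint_neg {K : Type*} [Field K] (q : K) (n : ℤ) : qint q (-n) = -qint q n := by
  unfold qint
  rw [neg_neg, ← neg_div, neg_sub]

theorem qint_ne_zero {K : Type*} [Field K] {q : K}
    (hq : ∀ n : ℕ, 1 ≤ n → q ^ (n : ℤ) ≠ q ^ (-(n : ℤ))) {n : ℕ} (hn : 1 ≤ n) :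
    qint q (n : ℤ) ≠ 0 := by
  refine div_ne_zero (sub_ne_zero.2 (hq n hn)) (sub_ne_zero.2 ?_)
  simpa using hq 1 le_rfl

theorem qbinomG_succ_mul {K : Type*} [Field K] {q : K}
    (hq : ∀ n : ℕ, 1 ≤ n → q ^ (n : ℤ) ≠ q ^ (-(n : ℤ))) (n : ℤ) (k : ℕ) :
    qbinomG q n (k + 1) * qint q ((k : ℤ) + 1) = qbinomG q n k * qint q (n - k) := by
  have h : qint q ((k : ℤ) + 1) ≠ 0 := by
    exact_mod_cast qint_ne_zero hq (Nat.succ_pos k)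
  rw [qbinomG, qbinomG, prod_range_succ, qfact, div_mul_eq_mul_div, mul_div_mul_right _ _ h,
    div_mul_eq_mul_div]

/-- The product identity behind the telescoping of the sum. -/
theorem qint_mul_qint_sub_qint_mul_qint {K : Type*} [Field K] {q : K} (hq0 : q ≠ 0)
    (d x r : ℤ) :
    qint q (x - r) * qint q (d - r) - qint q r * qint q (d - x + r) =
      qint q d * qint q (x - 2 * r) := by
  unfold qint
  rw [div_mul_div_comm, div_mul_div_comm, div_mul_div_comm, ← sub_div]
  congr 1
  simp only [sub_mul, mul_sub, ← zpow_add₀ hq0]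
  ring_nf

theorem qint_mul_sum_range {K : Type*} [Field K] {q : K} (hq0 : q ≠ 0)
    (hq : ∀ n : ℕ, 1 ≤ n → q ^ (n : ℤ) ≠ q ^ (-(n : ℤ))) (d : ℕ) (x : ℤ) (m : ℕ) (hm : m ≤ d) :
    qint q (d : ℤ) * ∑ r ∈ range m,
        qint q (x - 2 * (r : ℤ)) * qbinomG q (2 * (d : ℤ) - x) (d - r) * qbinomG q x r =
      qint q (m : ℤ) * qbinomG q x m *
        (qint q ((d : ℤ) - x + m) * qbinomG q (2 * (d : ℤ) - x) (d - m)) := by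
  induction m with
  | zero => simp [qint]
  | succ m ih =>
    obtain ⟨k, rfl⟩ := Nat.exists_eq_add_of_le hm
    have e₁ : m + 1 + k - m = k + 1 := by omega
    have e₂ : m + 1 + k - (m + 1) = k := by omega
    have h₁ := qbinomG_succ_mul hq x m
    have h₂ := qbinomG_succ_mul hq (2 * ((m + 1 + k : ℕ) : ℤ) - x) k
    have h₃ := qint_mul_qint_sub_qint_mul_qint hq0 ((m + 1 + k : ℕ) : ℤ) x m
    rw [sum_range_succ, mul_add, ih (by omega), e₁, e₂]
    have a₁ : 2 * ((m + 1 + k : ℕ) : ℤ) - x - k = ((m + 1 + k : ℕ) : ℤ) - x + (m + 1 : ℕ) := by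
      push_cast; ring
    have a₂ : ((m + 1 + k : ℕ) : ℤ) - m = k + 1 := by push_cast; ring
    have a₃ : ((m + 1 : ℕ) : ℤ) = m + 1 := by push_cast; ring
    rw [a₁] at h₂
    rw [a₂] at h₃
    rw [a₃] at h₂ ⊢
    linear_combination
      (-qbinomG q x m * qbinomG q (2 * ((m + 1 + k : ℕ) : ℤ) - x) (k + 1)) * h₃
      + qbinomG q x m * qint q (x - m) * h₂
      - qint q (((m + 1 + k : ℕ) : ℤ) - x + (m + 1))
        * qbinomG q (2 * ((m + 1 + k : ℕ) : ℤ) - x) k * h₁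

/-- For every integer `d ≥ 1` and every integer `x`:
`Σ_{r=0}^{d} [x−2r] [2d−x choose d−r] [x choose r] = 0`. -/
theorem stmt6 {K : Type*} [Field K] [CharZero K] (q : K) (hq0 : q ≠ 0)
    (hq : ∀ n : ℕ, 1 ≤ n → q ^ (n : ℤ) ≠ q ^ (-(n : ℤ)))
    (d : ℕ) (hd : 1 ≤ d) (x : ℤ) :
    ∑ r ∈ Finset.range (d + 1),
      qint q (x - 2 * (r : ℤ)) * qbinomG q (2 * (d : ℤ) - x) (d - r) * qbinomG q x r = 0 := by
  refine (mul_eq_zero.1 ?_).resolve_left (qint_ne_zero hq hd)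
  have h : x - 2 * (d : ℤ) = -((d : ℤ) - x + d) := by ring
  rw [sum_range_succ, mul_add, qint_mul_sum_range hq0 hq d x d le_rfl, h, qint_neg]
  ring
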